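/- arXiv:2105.06543 — 5 statements merged into one kernel-verified Lean document; each statement's English description precedes it below -/
import Mathlib

section
/- The total expected reward of the linear policy has the closed form ∑_{t=1}^H E[m_t + ⟨b_t, a_t⟩ + ⟨c_t, s_t⟩] = ∑_{t=1}^H ( m_t + ⟨b_t, μ_t^a⟩ + ⟨c_t, μ_t^s⟩ + ⟨ϑ_t b_t + c_t, R_{1,t−1}(s_1 − μ_1^s)⟩ ), where R_{1,0} denotes the n×n identity matrix. -/
open Matrix Finset MeasureTheory

theorem aux_dot {n : ℕ} {Ω : Type*} [MeasurableSpace Ω] (P : Measure Ω)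
    (X : Ω → Fin n → ℝ) (e w : Fin n → ℝ)
    (hi : ∀ k, Integrable (fun ω => X ω k) P) (he : ∀ k, ∫ ω, X ω k ∂P = e k) :
    Integrable (fun ω => w ⬝ᵥ X ω) P ∧ ∫ ω, w ⬝ᵥ X ω ∂P = w ⬝ᵥ e := by
  simp only [dotProduct]
  refine ⟨integrable_finsetSum _ fun k _ => (hi k).const_mul _, ?_⟩
  rw [integral_finsetSum _ fun k _ => (hi k).const_mul _]
  refine Finset.sum_congr rfl fun k _ => ?_
  rw [integral_const_mul, he]

/-- closed form of the expected total reward, Proposition 2(2) of the paper.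
With states driven by the linear dynamics `s (t+1) = μs (t+1) + B t (s t - μs t) + V (t+1) z (t+1)`
(integrable mean-zero noise, deterministic initial state `s1`), actions chosen by the linear
policy `a t = μa t + (ϑ t)ᵀ (s t - μs t)`, and per-period rewards
`r t = mc t + ⟨b t, a t⟩ + ⟨c t, s t⟩`, the expected total reward equals
`∑_{t=1}^H (mc t + ⟨b t, μa t⟩ + ⟨c t, μs t⟩ + ⟨ϑ t b t + c t, R 1 (t-1) (s1 - μs 1)⟩)`,
where `R 1 0` is the identity. -/
theorem stmt3 (n m H : ℕ) (hn : 1 ≤ n) (hm : 1 ≤ m) (hH : 2 ≤ H)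
    (βs : ℕ → Matrix (Fin n) (Fin n) ℝ) (βa : ℕ → Matrix (Fin m) (Fin n) ℝ)
    (μs : ℕ → Fin n → ℝ) (μa : ℕ → Fin m → ℝ)
    (ϑ : ℕ → Matrix (Fin n) (Fin m) ℝ)
    (B : ℕ → Matrix (Fin n) (Fin n) ℝ)
    (hB : ∀ t, B t = (βs t)ᵀ + (βa t)ᵀ * (ϑ t)ᵀ)
    (R : ℕ → ℕ → Matrix (Fin n) (Fin n) ℝ)
    (hRbase : ∀ t, R (t + 1) t = 1)
    (hRstep : ∀ h t, 1 ≤ h → h ≤ t → t ≤ H → R h t = R (h + 1) t * B h)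
    {Ω : Type*} [MeasurableSpace Ω] (P : Measure Ω) [IsProbabilityMeasure P]
    (V : ℕ → Matrix (Fin n) (Fin n) ℝ) (z : ℕ → Ω → Fin n → ℝ)
    (hzint : ∀ t, 2 ≤ t → t ≤ H → ∀ k, Integrable (fun ω => z t ω k) P)
    (hzmean : ∀ t, 2 ≤ t → t ≤ H → ∀ k, ∫ ω, z t ω k ∂P = 0)
    (s1 : Fin n → ℝ) (s : ℕ → Ω → Fin n → ℝ) (a : ℕ → Ω → Fin m → ℝ)
    (hs1 : ∀ ω, s 1 ω = s1)
    (ha : ∀ t, 1 ≤ t → t ≤ H → ∀ ω, a t ω = μa t + (ϑ t)ᵀ.mulVec (s t ω - μs t))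
    (hs : ∀ t, 1 ≤ t → t ≤ H - 1 → ∀ ω,
      s (t + 1) ω = μs (t + 1) + (B t).mulVec (s t ω - μs t)
        + (V (t + 1)).mulVec (z (t + 1) ω))
    (mc : ℕ → ℝ) (b : ℕ → Fin m → ℝ) (c : ℕ → Fin n → ℝ) :
    ∑ t ∈ Finset.Icc 1 H, ∫ ω, (mc t + b t ⬝ᵥ a t ω + c t ⬝ᵥ s t ω) ∂P
      = ∑ t ∈ Finset.Icc 1 H,
          (mc t + b t ⬝ᵥ μa t + c t ⬝ᵥ μs t
            + ((ϑ t).mulVec (b t) + c t) ⬝ᵥ (R 1 (t - 1)).mulVec (s1 - μs 1)) := by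
  have hR : ∀ d h, 1 ≤ h → h + d ≤ H → R h (h + d) = B (h + d) * R h (h + d - 1) := by
    intro d
    induction d with
    | zero =>
      intro h h1 h2
      obtain ⟨j, rfl⟩ : ∃ j, h = j + 1 := ⟨h - 1, by omega⟩
      have := hRstep (j + 1) (j + 1) h1 le_rfl (by omega)
      simp [this, hRbase]
    | succ d ih =>
      intro h h1 h2
      have e1 := hRstep h (h + (d + 1)) h1 (by omega) h2
      have e2 := hRstep h (h + d) h1 (by omega) (by omega)
      have e3 := ih (h + 1) (by omega) (by omega)
      have e4 : h + 1 + d = h + (d + 1) := by omega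
      have e5 : h + (d + 1) - 1 = h + d := by omega
      rw [e4, e5] at e3
      rw [e1, e3, e5, e2, Matrix.mul_assoc]
  have key : ∀ t, t + 1 ≤ H →
      (∀ k, Integrable (fun ω => (s (t + 1) ω - μs (t + 1)) k) P) ∧
      (∀ k, ∫ ω, (s (t + 1) ω - μs (t + 1)) k ∂P = ((R 1 t).mulVec (s1 - μs 1)) k) := by
    intro t
    induction t with
    | zero =>
      intro _
      simp [hs1, hRbase]
    | succ t ih =>
      intro ht
      obtain ⟨i1, i2⟩ := ih (by omega)
      have hd : ∀ k, (fun ω => (s (t + 1 + 1) ω - μs (t + 1 + 1)) k) =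
          fun ω => (B (t + 1) k) ⬝ᵥ (s (t + 1) ω - μs (t + 1))
            + (V (t + 1 + 1) k) ⬝ᵥ (z (t + 1 + 1) ω) := by
        intro k
        funext ω
        rw [hs (t + 1) (by omega) (by omega) ω]
        simp only [Pi.sub_apply, Pi.add_apply, Matrix.mulVec]
        ring
      have hz : ∀ k, ∫ ω, z (t + 1 + 1) ω k ∂P = (0 : Fin n → ℝ) k :=
        hzmean (t + 1 + 1) (by omega) ht
      have A := fun k => aux_dot P _ _ (B (t + 1) k) i1 i2
      have C := fun k => aux_dot P _ _ (V (t + 1 + 1) k)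
        (hzint (t + 1 + 1) (by omega) ht) hz
      have hRt : R 1 (t + 1) = B (t + 1) * R 1 t := by
        have := hR t 1 le_rfl (by omega)
        rwa [show 1 + t = t + 1 by omega] at this
      refine ⟨fun k => ?_, fun k => ?_⟩
      · rw [hd k]
        exact (A k).1.add (C k).1
      · rw [hd k, integral_add (A k).1 (C k).1, (A k).2, (C k).2, hRt,
          ← Matrix.mulVec_mulVec]
        simp [Matrix.mulVec]
  refine Finset.sum_congr rfl fun t ht => ?_
  obtain ⟨h1, h2⟩ := Finset.mem_Icc.mp ht
  obtain ⟨j, rfl⟩ : ∃ j, t = j + 1 := ⟨t - 1, by omega⟩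
  obtain ⟨i1, i2⟩ := key j h2
  have A := aux_dot P _ _ ((ϑ (j + 1)).mulVec (b (j + 1)) + c (j + 1)) i1 i2
  have hf : (fun ω => mc (j + 1) + b (j + 1) ⬝ᵥ a (j + 1) ω + c (j + 1) ⬝ᵥ s (j + 1) ω) =
      fun ω => (mc (j + 1) + b (j + 1) ⬝ᵥ μa (j + 1) + c (j + 1) ⬝ᵥ μs (j + 1)) +
        ((ϑ (j + 1)).mulVec (b (j + 1)) + c (j + 1)) ⬝ᵥ (s (j + 1) ω - μs (j + 1)) := by
    funext ω
    rw [ha (j + 1) h1 h2 ω, dotProduct_add, add_dotProduct, Matrix.dotProduct_mulVec,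
      Matrix.vecMul_transpose, dotProduct_sub (c (j + 1))]
    ring
  rw [hf, integral_add (integrable_const _) A.1, A.2]
  simp
end

section
/- Fix t with 1 ≤ t ≤ H and h with 1 ≤ h ≤ t, and view r̄_t as a function of the single matrix ϑ_h ∈ ℝ^{n×m} with all other policy coefficients held fixed. Then this function is differentiable, and its Fréchet derivative at ϑ_h applied to a direction E ∈ ℝ^{n×m} equals: b_tᵀ Eᵀ (s̄_t − μ_t^s) if h = t, and (c_t + ϑ_t b_t)ᵀ R_{h+1,t−1} (β_h^a)ᵀ Eᵀ (s̄_h − μ_h^s) if h < t, where R_{t,t−1} denotes the n×n identity matrix. -/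
open Matrix Finset

attribute [local instance] Matrix.normedAddCommGroup Matrix.normedSpace

theorem affine_aux {n m : ℕ} (f : Matrix (Fin n) (Fin m) ℝ → ℝ)
    (L : Matrix (Fin n) (Fin m) ℝ →ₗ[ℝ] ℝ) (K : ℝ) (hf : ∀ X, f X = K + L X)
    (X0 : Matrix (Fin n) (Fin m) ℝ) :
    ∃ D : Matrix (Fin n) (Fin m) ℝ →L[ℝ] ℝ, HasFDerivAt f D X0 ∧ ∀ E, D E = L E := by
  refine ⟨LinearMap.toContinuousLinearMap L, ?_, fun E => rfl⟩
  have h1 : f = fun X => K + (LinearMap.toContinuousLinearMap L) X := by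
    funext X
    exact hf X
  rw [h1]
  exact (ContinuousLinearMap.hasFDerivAt (LinearMap.toContinuousLinearMap L)).const_add K

/-- Theorem 2 of the paper, nested backpropagation: derivative of the
expected per-period reward with respect to a single policy matrix.
Fix `1 ≤ t ≤ H` and `1 ≤ h ≤ t`.  View the expected reward
`r̄ t = mc t + ⟨c t, s̄ t⟩ + ⟨b t, μa t + (ϑ t)ᵀ (s̄ t - μs t)⟩` as a function of the single
policy matrix `ϑ h = X` (other coefficients fixed), where the expected states satisfy
`sbar X 1 = s̄1` and
`sbar X (t'+1) = μs (t'+1) + ((βs t')ᵀ + (βa t')ᵀ (Θ t')ᵀ) (sbar X t' - μs t')`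
with `Θ t' = X` if `t' = h` and `Θ t' = ϑ t'` otherwise.  Then this function is (Fréchet)
differentiable at `ϑ h` and its derivative applied to a direction `E` equals
`b tᵀ Eᵀ (s̄ t - μs t)` if `h = t`, and
`(c t + ϑ t b t)ᵀ R (h+1) (t-1) (βa h)ᵀ Eᵀ (s̄ h - μs h)` if `h < t`, where
`R t (t-1)` is the identity and `R h' t' = B t' ⋯ B h'` with
`B t' = (βs t')ᵀ + (βa t')ᵀ (ϑ t')ᵀ`. -/
theorem stmt5 (n m H : ℕ) (hn : 1 ≤ n) (hm : 1 ≤ m) (hH : 2 ≤ H)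
    (βs : ℕ → Matrix (Fin n) (Fin n) ℝ) (βa : ℕ → Matrix (Fin m) (Fin n) ℝ)
    (μs : ℕ → Fin n → ℝ) (μa : ℕ → Fin m → ℝ)
    (ϑ : ℕ → Matrix (Fin n) (Fin m) ℝ)
    (R : ℕ → ℕ → Matrix (Fin n) (Fin n) ℝ)
    (hRbase : ∀ t, R (t + 1) t = 1)
    (hRstep : ∀ h t, 1 ≤ h → h ≤ t → t ≤ H →
      R h t = R (h + 1) t * ((βs h)ᵀ + (βa h)ᵀ * (ϑ h)ᵀ))
    (h t : ℕ) (hh1 : 1 ≤ h) (hht : h ≤ t) (ht1 : 1 ≤ t) (htH : t ≤ H)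
    (s1 : Fin n → ℝ)
    (sbar : Matrix (Fin n) (Fin m) ℝ → ℕ → Fin n → ℝ)
    (hsbar1 : ∀ X, sbar X 1 = s1)
    (hsbarstep : ∀ X t', 1 ≤ t' → t' ≤ H - 1 →
      sbar X (t' + 1) = μs (t' + 1)
        + ((βs t')ᵀ + (βa t')ᵀ * (if t' = h then X else ϑ t')ᵀ).mulVec
            (sbar X t' - μs t'))
    (mc : ℕ → ℝ) (b : ℕ → Fin m → ℝ) (c : ℕ → Fin n → ℝ) :
    ∃ D : Matrix (Fin n) (Fin m) ℝ →L[ℝ] ℝ,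
      HasFDerivAt (fun X =>
          mc t + c t ⬝ᵥ sbar X t
            + b t ⬝ᵥ (μa t + (if t = h then X else ϑ t)ᵀ.mulVec (sbar X t - μs t)))
        D (ϑ h) ∧
      ∀ E : Matrix (Fin n) (Fin m) ℝ,
        D E = if h = t then b t ⬝ᵥ (Eᵀ.mulVec (sbar (ϑ h) t - μs t))
          else (c t + (ϑ t).mulVec (b t)) ⬝ᵥ
            ((R (h + 1) (t - 1)).mulVec
              ((βa h)ᵀ.mulVec (Eᵀ.mulVec (sbar (ϑ h) h - μs h)))) := by
  have hconst : ∀ k, 1 ≤ k → k ≤ h → ∀ X, sbar X k = sbar (ϑ h) k := by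
    intro k hk
    induction k, hk using Nat.le_induction with
    | base => intro _ X; rw [hsbar1, hsbar1]
    | succ k hk ih =>
      intro hkh X
      have hne : k ≠ h := by omega
      rw [hsbarstep X k hk (by omega), hsbarstep (ϑ h) k hk (by omega), ih (by omega) X]
      simp only [if_neg hne]
  by_cases hEq : h = t
  · subst hEq
    simp only [if_true]
    refine affine_aux _
      { toFun := fun E => b h ⬝ᵥ (Eᵀ.mulVec (sbar (ϑ h) h - μs h))
        map_add' := fun E F => by
          rw [transpose_add, add_mulVec, dotProduct_add]
        map_smul' := fun r E => by
          rw [transpose_smul, smul_mulVec, dotProduct_smul]; rfl }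
      (mc h + c h ⬝ᵥ sbar (ϑ h) h + b h ⬝ᵥ μa h) ?_ _
    intro X
    rw [hconst h hh1 le_rfl X, dotProduct_add]
    simp only [LinearMap.coe_mk, AddHom.coe_mk]
    ring
  · have hlt : h < t := by omega
    have hne : t ≠ h := fun e => hEq e.symm
    simp only [if_neg hEq, if_neg hne]
    have hback : ∀ d k, k + d = t → h < k → ∀ X,
        sbar X t - μs t = (R k (t - 1)).mulVec (sbar X k - μs k) := by
      intro d
      induction d with
      | zero =>
        intro k hk hhk X
        have hkt : k = t := by omega
        subst hkt
        have h1 := hRbase (k - 1)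
        rw [Nat.sub_add_cancel ht1] at h1
        rw [h1, one_mulVec]
      | succ d ih =>
        intro k hk hhk X
        have hkh : k ≠ h := by omega
        rw [ih (k + 1) (by omega) (by omega) X,
          hRstep k (t - 1) (by omega) (by omega) (by omega),
          hsbarstep X k (by omega) (by omega), if_neg hkh, add_sub_cancel_left, mulVec_mulVec]
    have hform : ∀ X, sbar X t = μs t + ((R (h + 1) (t - 1)).mulVec
        ((βs h)ᵀ.mulVec (sbar (ϑ h) h - μs h)) + (R (h + 1) (t - 1)).mulVec
          ((βa h)ᵀ.mulVec (Xᵀ.mulVec (sbar (ϑ h) h - μs h)))) := by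
      intro X
      have h1 := hback (t - (h + 1)) (h + 1) (by omega) (by omega) X
      rw [hsbarstep X h hh1 (by omega), if_pos rfl, add_sub_cancel_left,
        hconst h hh1 le_rfl X, add_mulVec, mulVec_add, ← mulVec_mulVec] at h1
      rw [← h1]
      abel
    have hb : ∀ v : Fin n → ℝ, b t ⬝ᵥ ((ϑ t)ᵀ.mulVec v) = ((ϑ t).mulVec (b t)) ⬝ᵥ v := by
      intro v
      rw [dotProduct_mulVec, vecMul_transpose]
    refine affine_aux _
      { toFun := fun E => (c t + (ϑ t).mulVec (b t)) ⬝ᵥ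
            ((R (h + 1) (t - 1)).mulVec
              ((βa h)ᵀ.mulVec (Eᵀ.mulVec (sbar (ϑ h) h - μs h))))
        map_add' := fun E F => by
          rw [transpose_add, add_mulVec, mulVec_add, mulVec_add, dotProduct_add]
        map_smul' := fun r E => by
          rw [transpose_smul, smul_mulVec, mulVec_smul, mulVec_smul, dotProduct_smul]; rfl }
      (mc t + c t ⬝ᵥ μs t + b t ⬝ᵥ μa t + (c t + (ϑ t).mulVec (b t)) ⬝ᵥ
        ((R (h + 1) (t - 1)).mulVec ((βs h)ᵀ.mulVec (sbar (ϑ h) h - μs h)))) ?_ _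
    intro X
    rw [dotProduct_add (b t), hb, hform X, add_sub_cancel_left]
    simp only [LinearMap.coe_mk, AddHom.coe_mk, dotProduct_add, add_dotProduct]
    ring
end

section
/- Fix t with 2 ≤ t ≤ H and h with 1 ≤ h < t, and view s̄_t as a function of the single matrix ϑ_h ∈ ℝ^{n×m} with all other policy coefficients held fixed. Then this function is differentiable, and its Fréchet derivative at ϑ_h applied to a direction E ∈ ℝ^{n×m} equals R_{h+1,t−1} (β_h^a)ᵀ Eᵀ (s̄_h − μ_h^s) ∈ ℝ^n, where R_{t,t−1} denotes the n×n identity matrix. -/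
open Matrix Finset

attribute [local instance] Matrix.normedAddCommGroup Matrix.normedSpace

/-- derivative of the expected state with respect to a single policy
matrix; key step in the nested backpropagation Theorem 2 of the paper.
Fix `2 ≤ t ≤ H` and `1 ≤ h < t`.  View the expected state `s̄ t` as a function
`X ↦ sbar X t` of the single policy matrix `ϑ h = X`, all other coefficients held fixed:
`sbar X 1 = s̄1` and `sbar X (t'+1) = μs (t'+1) + ((βs t')ᵀ + (βa t')ᵀ (Θ t')ᵀ) (sbar X t' - μs t')`
with `Θ t' = X` if `t' = h` and `Θ t' = ϑ t'` otherwise.  Then this function is (Fréchet)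
differentiable at `ϑ h`, and its derivative applied to a direction `E` equals
`R (h+1) (t-1) (βa h)ᵀ Eᵀ (s̄ h - μs h)`, where `R t (t-1)` is the identity and
`R h' t' = B t' ⋯ B h'` is the pathway product of `B t' = (βs t')ᵀ + (βa t')ᵀ (ϑ t')ᵀ`. -/
theorem stmt6 (n m H : ℕ) (hn : 1 ≤ n) (hm : 1 ≤ m) (hH : 2 ≤ H)
    (βs : ℕ → Matrix (Fin n) (Fin n) ℝ) (βa : ℕ → Matrix (Fin m) (Fin n) ℝ)
    (μs : ℕ → Fin n → ℝ) (μa : ℕ → Fin m → ℝ)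
    (ϑ : ℕ → Matrix (Fin n) (Fin m) ℝ)
    (R : ℕ → ℕ → Matrix (Fin n) (Fin n) ℝ)
    (hRbase : ∀ t, R (t + 1) t = 1)
    (hRstep : ∀ h t, 1 ≤ h → h ≤ t → t ≤ H →
      R h t = R (h + 1) t * ((βs h)ᵀ + (βa h)ᵀ * (ϑ h)ᵀ))
    (h t : ℕ) (hh1 : 1 ≤ h) (hht : h < t) (ht2 : 2 ≤ t) (htH : t ≤ H)
    (s1 : Fin n → ℝ)
    (sbar : Matrix (Fin n) (Fin m) ℝ → ℕ → Fin n → ℝ)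
    (hsbar1 : ∀ X, sbar X 1 = s1)
    (hsbarstep : ∀ X t', 1 ≤ t' → t' ≤ H - 1 →
      sbar X (t' + 1) = μs (t' + 1)
        + ((βs t')ᵀ + (βa t')ᵀ * (if t' = h then X else ϑ t')ᵀ).mulVec
            (sbar X t' - μs t')) :
    ∃ D : Matrix (Fin n) (Fin m) ℝ →L[ℝ] (Fin n → ℝ),
      HasFDerivAt (fun X => sbar X t) D (ϑ h) ∧
      ∀ E : Matrix (Fin n) (Fin m) ℝ,
        D E = (R (h + 1) (t - 1)).mulVec
          ((βa h)ᵀ.mulVec (Eᵀ.mulVec (sbar (ϑ h) h - μs h))) := by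
  have hind : ∀ k, 1 ≤ k → k ≤ h → ∀ X Y, sbar X k = sbar Y k := by
    intro k hk
    induction k, hk using Nat.le_induction with
    | base => intro _ X Y; rw [hsbar1, hsbar1]
    | succ k hk ih =>
      intro hkh X Y
      rw [hsbarstep X k hk (by omega), hsbarstep Y k hk (by omega), ih (by omega) X Y,
        if_neg (by omega), if_neg (by omega)]
  have hR : ∀ d a k, 1 ≤ a → a + d = k + 1 → k + 1 ≤ H →
      R a (k + 1) = ((βs (k + 1))ᵀ + (βa (k + 1))ᵀ * (ϑ (k + 1))ᵀ) * R a k := by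
    intro d
    induction d with
    | zero =>
      intro a k ha hak hk
      obtain rfl : a = k + 1 := by omega
      rw [hRstep _ _ ha le_rfl hk, hRbase, hRbase, one_mul, mul_one]
    | succ d ih =>
      intro a k ha hak hk
      rw [hRstep a (k + 1) ha (by omega) hk, hRstep a k ha (by omega) (by omega),
        ih (a + 1) k (by omega) (by omega) hk, Matrix.mul_assoc]
  have key : ∀ k, h + 1 ≤ k → k ≤ H → ∀ X, sbar X k = sbar (ϑ h) k +
      (R (h + 1) (k - 1)).mulVec
        ((βa h)ᵀ.mulVec ((X - ϑ h)ᵀ.mulVec (sbar (ϑ h) h - μs h))) := by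
    intro k hk
    induction k, hk using Nat.le_induction with
    | base =>
      intro hkH X
      rw [hsbarstep X h hh1 (by omega), hsbarstep (ϑ h) h hh1 (by omega),
        hind h hh1 le_rfl X (ϑ h), if_pos rfl, if_pos rfl, Nat.add_sub_cancel, hRbase,
        Matrix.one_mulVec]
      simp only [Matrix.transpose_sub, Matrix.sub_mulVec, Matrix.add_mulVec,
        Matrix.mulVec_sub, ← Matrix.mulVec_mulVec]
      abel
    | succ k hk ih =>
      intro hkH X
      obtain ⟨j, rfl⟩ : ∃ j, k = j + 1 := ⟨k - 1, by omega⟩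
      rw [hsbarstep X (j + 1) (by omega) (by omega),
        hsbarstep (ϑ h) (j + 1) (by omega) (by omega), if_neg (by omega), if_neg (by omega),
        ih (by omega) X, Nat.add_sub_cancel, Nat.add_sub_cancel,
        hR (j - h) (h + 1) j (by omega) (by omega) (by omega),
        add_sub_right_comm, Matrix.mulVec_add, ← Matrix.mulVec_mulVec]
      abel
  let L : Matrix (Fin n) (Fin m) ℝ →ₗ[ℝ] (Fin n → ℝ) :=
    { toFun := fun E => (R (h + 1) (t - 1)).mulVec
          ((βa h)ᵀ.mulVec (Eᵀ.mulVec (sbar (ϑ h) h - μs h)))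
      map_add' := fun A B => by
        simp only [Matrix.transpose_add, Matrix.add_mulVec, Matrix.mulVec_add]
      map_smul' := fun c A => by
        simp only [Matrix.transpose_smul, Matrix.smul_mulVec, Matrix.mulVec_smul,
          RingHom.id_apply] }
  refine ⟨LinearMap.toContinuousLinearMap L, ?_, fun E => rfl⟩
  have hf : (fun X => sbar X t) = fun X => sbar (ϑ h) t +
      LinearMap.toContinuousLinearMap L (X - ϑ h) := by
    funext X
    exact key t hht htH X
  rw [hf]
  have h1 := ((LinearMap.toContinuousLinearMap L).hasFDerivAt (x := ϑ h)).add_const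
    (sbar (ϑ h) t - LinearMap.toContinuousLinearMap L (ϑ h))
  refine h1.congr_of_eventuallyEq (Filter.Eventually.of_forall fun X => ?_)
  simp only [map_sub]
  abel
end

section
/- For every B_W > 0 and B_C > 0 there exists a constant L ≥ 0 such that for every Borel probability measure P on the space of model parameters with P(𝒲(B_W)) = 1, the averaged objective 𝒥(θ) = ∫ J(θ; w) dP(w) has L-Lipschitz gradient on 𝒞(B_C): ‖∇𝒥(θ) − ∇𝒥(θ′)‖ ≤ L ‖θ − θ′‖ for all θ, θ′ ∈ 𝒞(B_C). -/
open MeasureTheory Finset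

/-- Euclidean norm of a vector given as a function on `Fin a`. -/
noncomputable def vnorm {a : ℕ} (v : Fin a → ℝ) : ℝ := Real.sqrt (∑ i, (v i) ^ 2)

/-- Frobenius norm of a matrix given as a function. -/
noncomputable def fnorm {a b : ℕ} (M : Fin a → Fin b → ℝ) : ℝ :=
  Real.sqrt (∑ i, ∑ j, (M i j) ^ 2)

/-- The space of model parameters `w = (βˢ, βᵃ, μˢ, μᵃ)`: for each of the `H` periods an
`n×n` matrix `βˢ_t`, an `m×n` matrix `βᵃ_t`, and vectors `μˢ_t ∈ ℝⁿ`, `μᵃ_t ∈ ℝᵐ`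
(matrices/vectors are represented as functions, so this is a finite-dimensional real
vector space carrying its Borel σ-algebra). -/
abbrev ModelParam (n m H : ℕ) :=
  (Fin H → Fin n → Fin n → ℝ) × (Fin H → Fin m → Fin n → ℝ)
    × (Fin H → Fin n → ℝ) × (Fin H → Fin m → ℝ)

/-- The space of policy parameters `θ = (ϑ_1, …, ϑ_H)`, each `ϑ_t` an `n×m` matrix. -/
abbrev PolicyParam (n m H : ℕ) := Fin H → Fin n → Fin m → ℝ

/-- `B_t(θ, w) = (βˢ_t)ᵀ + (βᵃ_t)ᵀ ϑ_tᵀ`, entrywise: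
`(B_t)_{ij} = (βˢ_t)_{ji} + ∑_k (βᵃ_t)_{ki} (ϑ_t)_{jk}`. -/
noncomputable def Bmat (n m H : ℕ) (θ : PolicyParam n m H) (w : ModelParam n m H)
    (t : Fin H) : Fin n → Fin n → ℝ :=
  fun i j => w.1 t j i + ∑ k, w.2.1 t k i * θ t j k

/-- Pathway products: `Rpre k = B_k B_{k-1} ⋯ B_1` (with periods labelled `1,…,H` via
`Fin H`), so `Rpre 0 = I` and `Rpre k` is the paper's `R_{1,k}(θ,w)`. -/
noncomputable def Rpre (n m H : ℕ) (θ : PolicyParam n m H) (w : ModelParam n m H) :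
    ℕ → Fin n → Fin n → ℝ
  | 0 => fun i j => if i = j then (1 : ℝ) else 0
  | (k + 1) =>
      if hk : k < H then
        fun i j => ∑ l, Bmat n m H θ w ⟨k, hk⟩ i l * Rpre n m H θ w k l j
      else Rpre n m H θ w k

/-- The objective
`J(θ; w) = ∑_{t=1}^H (m_t + ⟨b_t, μᵃ_t⟩ + ⟨c_t, μˢ_t⟩ + ⟨ϑ_t b_t + c_t, R_{1,t-1}(θ,w)(s_1 - μˢ_1)⟩)`. -/
noncomputable def Jobj (n m H : ℕ) (hH : 0 < H) (mc : Fin H → ℝ) (b : Fin H → Fin m → ℝ)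
    (c : Fin H → Fin n → ℝ) (s1 : Fin n → ℝ)
    (θ : PolicyParam n m H) (w : ModelParam n m H) : ℝ :=
  ∑ t : Fin H,
    (mc t + (∑ i, b t i * w.2.2.2 t i) + (∑ i, c t i * w.2.2.1 t i)
      + ∑ i, ((∑ j, θ t i j * b t j) + c t i)
          * (∑ l, Rpre n m H θ w t.val i l * (s1 l - w.2.2.1 ⟨0, hH⟩ l)))

/-- `𝒲(B_W)`: model parameters all of whose matrix (Frobenius) and vector (Euclidean)
components have norm at most `B_W`. -/
def SetW (n m H : ℕ) (BW : ℝ) : Set (ModelParam n m H) :=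
  {w | (∀ t, fnorm (w.1 t) ≤ BW) ∧ (∀ t, fnorm (w.2.1 t) ≤ BW)
    ∧ (∀ t, vnorm (w.2.2.1 t) ≤ BW) ∧ (∀ t, vnorm (w.2.2.2 t) ≤ BW)}

/-- `𝒞(B_C)`: policy parameters with `‖ϑ_t‖_F ≤ B_C` for all `t`. -/
def SetC (n m H : ℕ) (BC : ℝ) : Set (PolicyParam n m H) :=
  {θ | ∀ t, fnorm (θ t) ≤ BC}

theorem general_smooth {E W : Type*} [NormedAddCommGroup E] [NormedSpace ℝ E]
    [FiniteDimensional ℝ E] [NormedAddCommGroup W] [NormedSpace ℝ W] [FiniteDimensional ℝ W]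
    [MeasurableSpace W] [BorelSpace W] (f : E × W → ℝ) (hf : ContDiff ℝ 2 f) (R S : ℝ) :
    ∃ L : ℝ, 0 ≤ L ∧ ∀ (P : Measure W), IsProbabilityMeasure P →
      (∀ᵐ w ∂P, w ∈ Metric.closedBall (0 : W) S) →
      ∀ θ ∈ Metric.closedBall (0 : E) R, ∀ θ' ∈ Metric.closedBall (0 : E) R,
        ‖fderiv ℝ (fun x => ∫ w, f (x, w) ∂P) θ - fderiv ℝ (fun x => ∫ w, f (x, w) ∂P) θ'‖
          ≤ L * ‖θ - θ'‖ := by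
  haveI : ProperSpace E := FiniteDimensional.proper ℝ E
  haveI : ProperSpace W := FiniteDimensional.proper ℝ W
  let G : E × W → (E →L[ℝ] ℝ) := fun p => (fderiv ℝ f p).comp (ContinuousLinearMap.inl ℝ E W)
  have hG : ContDiff ℝ 1 G :=
    (hf.fderiv_right (m := 1) (by norm_num)).clm_comp contDiff_const
  let K : Set (E × W) := Metric.closedBall (0 : E) (R + 1) ×ˢ Metric.closedBall (0 : W) S
  have hK : IsCompact K := (isCompact_closedBall _ _).prod (isCompact_closedBall _ _)
  have hKc : Convex ℝ K := (convex_closedBall _ _).prod (convex_closedBall _ _)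
  obtain ⟨C0, hC0⟩ := hK.exists_bound_of_continuousOn hf.continuous.continuousOn
  obtain ⟨C1, hC1⟩ := hK.exists_bound_of_continuousOn hG.continuous.continuousOn
  obtain ⟨C2, hC2⟩ := hK.exists_bound_of_continuousOn
    (hG.continuous_fderiv (by norm_num)).continuousOn
  refine ⟨max C2 0, le_max_right _ _, ?_⟩
  intro P hP hS
  have hFm : ∀ x, AEStronglyMeasurable (fun w => f (x, w)) P := fun x =>
    (hf.continuous.comp (by fun_prop : Continuous fun w : W => (x, w))).aestronglyMeasurable
  have hGm : ∀ x, AEStronglyMeasurable (fun w => G (x, w)) P := fun x =>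
    (hG.continuous.comp (by fun_prop : Continuous fun w : W => (x, w))).aestronglyMeasurable
  have hsub : ∀ x ∈ Metric.closedBall (0 : E) R, x ∈ Metric.closedBall (0 : E) (R + 1) :=
    fun x hx => Metric.closedBall_subset_closedBall (by linarith) hx
  have hGi : ∀ x ∈ Metric.closedBall (0 : E) R, Integrable (fun w => G (x, w)) P := by
    intro x hx
    refine Integrable.of_bound (hGm x) C1 ?_
    filter_upwards [hS] with w hw
    exact hC1 _ ⟨hsub x hx, hw⟩
  have key : ∀ x ∈ Metric.closedBall (0 : E) R,
      HasFDerivAt (fun x => ∫ w, f (x, w) ∂P) (∫ w, G (x, w) ∂P) x := by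
    intro x hx
    refine hasFDerivAt_integral_of_dominated_of_fderiv_le (F' := fun x w => G (x, w))
      (bound := fun _ => C1)
      (Metric.ball_mem_nhds x one_pos) (Filter.Eventually.of_forall hFm) ?_ (hGm x) ?_
      (integrable_const _) ?_
    · refine Integrable.of_bound (hFm x) C0 ?_
      filter_upwards [hS] with w hw
      exact hC0 _ ⟨hsub x hx, hw⟩
    · filter_upwards [hS] with w hw y hy
      refine hC1 _ ⟨?_, hw⟩
      rw [mem_closedBall_zero_iff] at hx ⊢
      rw [mem_ball_iff_norm] at hy
      have := norm_le_norm_add_norm_sub' y x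
      linarith
    · refine Filter.Eventually.of_forall fun w y _ => ?_
      have h1 : HasFDerivAt f (fderiv ℝ f (y, w)) (y, w) :=
        (hf.differentiable (by norm_num) _).hasFDerivAt
      exact h1.comp y (hasFDerivAt_prodMk_left y w)
  intro θ hθ θ' hθ'
  rw [(key θ hθ).fderiv, (key θ' hθ').fderiv, ← integral_sub (hGi θ hθ) (hGi θ' hθ')]
  have hb : ∀ᵐ w ∂P, ‖G (θ, w) - G (θ', w)‖ ≤ max C2 0 * ‖θ - θ'‖ := by
    filter_upwards [hS] with w hw
    have := hKc.norm_image_sub_le_of_norm_fderiv_le (f := G) (C := max C2 0) (𝕜 := ℝ)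
      (x := (θ', w)) (y := (θ, w))
      (fun p _ => hG.differentiable (by norm_num) p)
      (fun p hp => (hC2 p hp).trans (le_max_left _ _)) ⟨hsub _ hθ', hw⟩ ⟨hsub _ hθ, hw⟩
    simpa [Prod.norm_def] using this
  simpa using norm_integral_le_of_norm_le_const hb

theorem contDiff_Rpre (n m H : ℕ) (k : ℕ) (i j : Fin n) :
    ContDiff ℝ 2 (fun p : PolicyParam n m H × ModelParam n m H => Rpre n m H p.1 p.2 k i j) := by
  induction k generalizing i j with
  | zero => exact contDiff_const
  | succ k ih =>
    by_cases hk : k < H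
    · simp only [Rpre, hk, dif_pos, Bmat]
      fun_prop
    · simpa only [Rpre, hk, dif_neg, not_false_eq_true] using ih i j

theorem contDiff_Jobj (n m H : ℕ) (hH : 0 < H)
    (mc : Fin H → ℝ) (b : Fin H → Fin m → ℝ) (c : Fin H → Fin n → ℝ) (s1 : Fin n → ℝ) :
    ContDiff ℝ 2 (fun p : PolicyParam n m H × ModelParam n m H =>
      Jobj n m H hH mc b c s1 p.1 p.2) := by
  have := contDiff_Rpre n m H
  unfold Jobj
  fun_prop

theorem norm_le_of_vnorm {a : ℕ} (v : Fin a → ℝ) {B : ℝ} (hB : 0 ≤ B) (h : vnorm v ≤ B) :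
    ‖v‖ ≤ B := by
  refine (pi_norm_le_iff_of_nonneg hB).2 fun i => le_trans (Real.abs_le_sqrt ?_) h
  exact Finset.single_le_sum (f := fun i => (v i) ^ 2) (fun _ _ => sq_nonneg _) (mem_univ i)

theorem norm_le_of_fnorm {a b : ℕ} (M : Fin a → Fin b → ℝ) {B : ℝ} (hB : 0 ≤ B)
    (h : fnorm M ≤ B) : ‖M‖ ≤ B := by
  refine (pi_norm_le_iff_of_nonneg hB).2 fun i => norm_le_of_vnorm _ hB ?_
  refine le_trans (Real.sqrt_le_sqrt ?_) h
  exact Finset.single_le_sum (f := fun i => ∑ j, (M i j) ^ 2)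
    (fun _ _ => Finset.sum_nonneg fun _ _ => sq_nonneg _) (mem_univ i)

/-- Lemma 1 of the paper: the averaged objective `𝒥` is L-smooth.
For every `B_W > 0` and `B_C > 0` there is a constant `L ≥ 0` such that for every
(Borel) probability measure `P` on model parameters with `P(𝒲(B_W)) = 1`, the averaged
objective `𝒥(θ) = ∫ J(θ; w) dP(w)` has `L`-Lipschitz gradient on `𝒞(B_C)`. -/
theorem stmt9 (n m H : ℕ) (hn : 1 ≤ n) (hm : 1 ≤ m) (hH : 0 < H)
    (mc : Fin H → ℝ) (b : Fin H → Fin m → ℝ) (c : Fin H → Fin n → ℝ) (s1 : Fin n → ℝ)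
    (BW BC : ℝ) (hBW : 0 < BW) (hBC : 0 < BC) :
    ∃ L : ℝ, 0 ≤ L ∧
      ∀ (P : Measure (ModelParam n m H)), IsProbabilityMeasure P →
        P (SetW n m H BW) = 1 →
        ∀ θ ∈ SetC n m H BC, ∀ θ' ∈ SetC n m H BC,
          ‖fderiv ℝ (fun x => ∫ w, Jobj n m H hH mc b c s1 x w ∂P) θ
              - fderiv ℝ (fun x => ∫ w, Jobj n m H hH mc b c s1 x w ∂P) θ'‖
            ≤ L * ‖θ - θ'‖ := by
  obtain ⟨L, hL, h⟩ := general_smooth _ (contDiff_Jobj n m H hH mc b c s1) BC BW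
  refine ⟨L, hL, fun P hP hPW θ hθ θ' hθ' => ?_⟩
  have hC : ∀ x ∈ SetC n m H BC, x ∈ Metric.closedBall (0 : PolicyParam n m H) BC := by
    intro x hx
    rw [mem_closedBall_zero_iff]
    exact (pi_norm_le_iff_of_nonneg hBC.le).2 fun t => norm_le_of_fnorm _ hBC.le (hx t)
  have hW : SetW n m H BW ⊆ Metric.closedBall (0 : ModelParam n m H) BW := by
    rintro ⟨w1, w2, w3, w4⟩ ⟨h1, h2, h3, h4⟩
    rw [mem_closedBall_zero_iff]
    simp only [Prod.norm_mk, max_le_iff]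
    exact ⟨(pi_norm_le_iff_of_nonneg hBW.le).2 fun t => norm_le_of_fnorm _ hBW.le (h1 t),
      (pi_norm_le_iff_of_nonneg hBW.le).2 fun t => norm_le_of_fnorm _ hBW.le (h2 t),
      (pi_norm_le_iff_of_nonneg hBW.le).2 fun t => norm_le_of_vnorm _ hBW.le (h3 t),
      (pi_norm_le_iff_of_nonneg hBW.le).2 fun t => norm_le_of_vnorm _ hBW.le (h4 t)⟩
  have hae : ∀ᵐ w ∂P, w ∈ Metric.closedBall (0 : ModelParam n m H) BW := by
    refine (mem_ae_iff_prob_eq_one Metric.isClosed_closedBall.measurableSet).2 ?_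
    exact le_antisymm prob_le_one (hPW ▸ measure_mono hW)
  exact h P hP hae θ (hC θ hθ) θ' (hC θ' hθ')
end

section
/- Suppose that for μ-almost every w and every η ∈ [0, c₀], one has θ + η f(w)/‖f(w)‖ ∈ C whenever f(w) ≠ 0. Then for every η ∈ [0, c₀/G], the averaged step stays feasible: θ + η ∫ f dμ ∈ C. -/
open MeasureTheory

/-- Step 1 of Lemma 2 of the paper: the averaged step stays feasible.
Let `C ⊆ ℝ^p` be closed and convex, `θ ∈ C`, `c₀, G > 0`, and let `f` be a Bochner
integrable random vector on a probability space `(W, μ)` with `‖f(w)‖ ≤ G` a.e.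
If for a.e. `w` and every `η ∈ [0, c₀]` one has `θ + η f(w)/‖f(w)‖ ∈ C` whenever
`f(w) ≠ 0`, then for every `η ∈ [0, c₀/G]` we have `θ + η ∫ f dμ ∈ C`. -/
theorem stmt13 (p : ℕ) (hp : 1 ≤ p) (C : Set (EuclideanSpace ℝ (Fin p)))
    (hCclosed : IsClosed C) (hCconv : Convex ℝ C)
    (θ : EuclideanSpace ℝ (Fin p)) (hθ : θ ∈ C)
    (c₀ G : ℝ) (hc₀ : 0 < c₀) (hG : 0 < G)
    {W : Type*} [MeasurableSpace W] (μ : Measure W) [IsProbabilityMeasure μ]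
    (f : W → EuclideanSpace ℝ (Fin p)) (hfint : Integrable f μ)
    (hfbound : ∀ᵐ w ∂μ, ‖f w‖ ≤ G)
    (hstep : ∀ᵐ w ∂μ, ∀ η ∈ Set.Icc (0 : ℝ) c₀,
      f w ≠ 0 → θ + η • (‖f w‖⁻¹ • f w) ∈ C) :
    ∀ η ∈ Set.Icc (0 : ℝ) (c₀ / G), θ + η • (∫ w, f w ∂μ) ∈ C := by
  rintro η ⟨h0, h1⟩
  rw [le_div_iff₀ hG] at h1
  have hint : Integrable (fun w => θ + η • f w) μ :=
    (integrable_const θ).add (hfint.smul η)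
  have key : ∀ᵐ w ∂μ, θ + η • f w ∈ C := by
    filter_upwards [hfbound, hstep] with w hb hs
    by_cases hz : f w = 0
    · simpa [hz] using hθ
    · have hn : ‖f w‖ ≠ 0 := norm_ne_zero_iff.mpr hz
      have h := hs (η * ‖f w‖)
        ⟨by positivity, (mul_le_mul_of_nonneg_left hb h0).trans h1⟩ hz
      rwa [smul_smul, mul_assoc, mul_inv_cancel₀ hn, mul_one] at h
  have h := hCconv.integral_mem hCclosed key hint
  have e : ∫ w, (θ + η • f w) ∂μ = θ + η • ∫ w, f w ∂μ := by
    have hs : Integrable (fun w => η • f w) μ := hfint.smul η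
    rw [integral_add (integrable_const θ) hs, integral_smul]
    simp
  rwa [e] at h
end
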